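/- arXiv:1907.02304 — 2 statements merged into one kernel-verified Lean document; each statement's English description precedes it below -/
import Mathlib

section
/- Assume in addition that χ is continuously differentiable with ‖Dχ‖_∞ ≤ K for some K > 0 and that d_min ≤ 2W. Then there is a constant C > 0 depending only on K such that for every x ∈ ℝ³: ‖∫_{ℝ³} D(χ_{d_min}Φ)(x − T(y)) dμ(y)‖ ≤ C·(M·W³/d_min² + M + 1), where D(χ_{d_min}Φ) denotes the Fréchet derivative of the truncated Oseen kernel. -/
open MeasureTheory
open scoped ENNReal NNReal

noncomputable section

/-- Euclidean `ℝ³`. -/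
abbrev E3 : Type := EuclideanSpace ℝ (Fin 3)

/-- The Oseen tensor `Φ(x) = (1/(8π)) (‖x‖⁻¹ I + ‖x‖⁻³ x xᵀ)`, viewed as a continuous
linear map on `ℝ³` (the outer product `x xᵀ` acts as `y ↦ ⟪x, y⟫ x`); for `x = 0` the
formula gives `0` by the convention `0⁻¹ = 0`. -/
def oseenTensor (x : E3) : E3 →L[ℝ] E3 :=
  (8 * Real.pi)⁻¹ • (‖x‖⁻¹ • ContinuousLinearMap.id ℝ E3 +
    (‖x‖ ^ 3)⁻¹ • (innerSL ℝ x).smulRight x)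

/-- The truncated Oseen kernel `(χ_d Φ)(z) = χ(z/d) Φ(z)` (equal to `0` at `z = 0`,
since `χ` vanishes near the origin). -/
def truncOseen (χ : E3 → ℝ) (d : ℝ) (z : E3) : E3 →L[ℝ] E3 :=
  χ (d⁻¹ • z) • oseenTensor z


lemma oseenTensor_smul {c : ℝ} (hc : 0 < c) (x : E3) :
    oseenTensor (c • x) = c⁻¹ • oseenTensor x := by
  ext1 v
  simp only [oseenTensor, norm_smul, Real.norm_of_nonneg hc.le, smul_apply,
    add_apply, ContinuousLinearMap.smulRight_apply, innerSL_apply_apply,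
    inner_smul_left, ContinuousLinearMap.id_apply, smul_add, smul_smul, conj_trivial]
  congr 2 <;> field_simp

lemma contDiffAt_oseenTensor {x : E3} (hx : x ≠ 0) : ContDiffAt ℝ 1 oseenTensor x := by
  have hn : ContDiffAt ℝ 1 (fun y : E3 => ‖y‖) x := contDiffAt_norm ℝ hx
  have h0 : ‖x‖ ≠ 0 := norm_ne_zero_iff.2 hx
  unfold oseenTensor
  have hi : ContDiffAt ℝ 1 (fun y : E3 => (innerSL ℝ y).smulRight y) x :=
    (innerSL ℝ).contDiff.contDiffAt.smulRight contDiffAt_id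
  exact (((hn.inv h0).smul contDiffAt_const).add
    (((hn.pow 3).inv (pow_ne_zero 3 h0)).smul hi)).const_smul _

set_option maxSynthPendingDepth 3 in
/-- The Oseen tensor decays like `‖x‖⁻¹` and its derivative like `‖x‖⁻²`. -/
lemma exists_norm_oseenTensor_le : ∃ B : ℝ, 0 < B ∧ ∀ x : E3, x ≠ 0 →
    ‖oseenTensor x‖ ≤ B / ‖x‖ ∧ ‖fderiv ℝ oseenTensor x‖ ≤ B / ‖x‖ ^ 2 := by
  have hs : IsCompact (Metric.sphere (0 : E3) 1) := isCompact_sphere 0 1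
  have hne : ∀ x ∈ Metric.sphere (0 : E3) 1, x ≠ 0 := fun x hx =>
    ne_zero_of_mem_unit_sphere ⟨x, hx⟩
  obtain ⟨B₁, hB₁⟩ := hs.exists_bound_of_continuousOn (f := oseenTensor) fun x hx =>
    (contDiffAt_oseenTensor (hne x hx)).continuousAt.continuousWithinAt
  obtain ⟨B₂, hB₂⟩ := hs.exists_bound_of_continuousOn (f := fderiv ℝ oseenTensor) fun x hx =>
    ((contDiffAt_oseenTensor (hne x hx)).continuousAt_fderiv one_ne_zero).continuousWithinAt
  refine ⟨max 1 (max B₁ B₂), by positivity, fun x hx => ?_⟩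
  have h0 : 0 < ‖x‖ := norm_pos_iff.2 hx
  have hc : 0 < ‖x‖⁻¹ := inv_pos.2 h0
  have hmem : ‖x‖⁻¹ • x ∈ Metric.sphere (0 : E3) 1 := by
    simp [norm_smul, h0.ne']
  have hscale : oseenTensor = fun y => ‖x‖⁻¹ • oseenTensor (‖x‖⁻¹ • y) := by
    ext1 y
    rw [oseenTensor_smul hc, smul_smul, mul_inv_cancel₀ hc.ne', one_smul]
  constructor
  · rw [congrFun hscale x, norm_smul, norm_inv, norm_norm, div_eq_inv_mul]
    gcongr
    exact (hB₁ _ hmem).trans (by simp)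
  · have hd : DifferentiableAt ℝ (fun y => oseenTensor (‖x‖⁻¹ • y)) x :=
      DifferentiableAt.comp x (g := oseenTensor)
        ((contDiffAt_oseenTensor (hne _ hmem)).differentiableAt one_ne_zero)
        (differentiableAt_id.fun_const_smul _)
    rw [hscale, fderiv_fun_const_smul hd, fderiv_comp_smul, smul_smul, norm_smul,
      Real.norm_of_nonneg (by positivity), div_eq_inv_mul, pow_two, mul_inv]
    gcongr
    exact (hB₂ _ hmem).trans (by simp)

set_option maxSynthPendingDepth 3 in
/-- The derivative of the truncated Oseen kernel decays like `‖z‖⁻²` and is at most of order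
`d⁻²`. -/
lemma exists_norm_fderiv_truncOseen_le {K : ℝ} (hK : 0 < K) : ∃ A : ℝ, 0 < A ∧
    ∀ χ : E3 → ℝ, (∀ z : E3, χ z ∈ Set.Icc (0 : ℝ) 1) → (∀ z : E3, ‖z‖ ≤ 1 / 4 → χ z = 0) →
      (∀ z : E3, 1 / 2 ≤ ‖z‖ → χ z = 1) → ContDiff ℝ 1 χ → (∀ z : E3, ‖fderiv ℝ χ z‖ ≤ K) →
      ∀ d : ℝ, 0 < d → ∀ z : E3, ‖fderiv ℝ (truncOseen χ d) z‖ ≤ A / ‖z‖ ^ 2 ∧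
        ‖fderiv ℝ (truncOseen χ d) z‖ ≤ A / d ^ 2 := by
  obtain ⟨B, hB, hΦ⟩ := exists_norm_oseenTensor_le
  refine ⟨16 * (B + K * B), by positivity, fun χ h01 hχ0 hχ1 hχ hχK d hd z => ?_⟩
  have hn (y : E3) : ‖d⁻¹ • y‖ = ‖y‖ / d := by
    rw [norm_smul, norm_inv, Real.norm_of_nonneg hd.le, div_eq_inv_mul]
  rcases lt_or_ge ‖z‖ (d / 4) with hz | hz
  · have hev : truncOseen χ d =ᶠ[nhds z] fun _ => 0 := by
      filter_upwards [continuous_norm.continuousAt.eventually_lt_const hz] with y hy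
      have : χ (d⁻¹ • y) = 0 := hχ0 _ (by rw [hn, div_le_iff₀ hd]; linarith)
      rw [truncOseen, this]
      exact zero_smul ℝ (oseenTensor y)
    have h0 : ‖fderiv ℝ (truncOseen χ d) z‖ = 0 := by
      rw [hev.fderiv_eq, fderiv_fun_const]
      exact norm_zero
    rw [h0]
    exact ⟨by positivity, by positivity⟩
  · have hz0 : 0 < ‖z‖ := by linarith
    obtain ⟨hΦ₀, hΦ₁⟩ := hΦ z (norm_pos_iff.1 hz0)
    have hχd : DifferentiableAt ℝ (fun y => χ (d⁻¹ • y)) z :=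
      ((hχ.differentiable one_ne_zero).comp (differentiable_id.const_smul d⁻¹)) z
    have hcut : ‖fderiv ℝ (fun y => χ (d⁻¹ • y)) z‖ ≤ K / ‖z‖ := by
      rcases le_or_gt ‖z‖ (d / 2) with hz' | hz'
      · rw [fderiv_comp_smul, norm_smul, norm_inv, Real.norm_of_nonneg hd.le, div_eq_inv_mul]
        gcongr
        · linarith
        · exact hχK _
      · have hev : (fun y => χ (d⁻¹ • y)) =ᶠ[nhds z] fun _ => 1 := by
          filter_upwards [continuous_norm.continuousAt.eventually_const_lt hz'] with y hy
          exact hχ1 _ (by rw [hn, le_div_iff₀ hd]; linarith)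
        rw [hev.fderiv_eq]
        simp only [fderiv_fun_const, Pi.zero_apply, norm_zero]
        positivity
    have key : ‖fderiv ℝ (truncOseen χ d) z‖ ≤ (B + K * B) / ‖z‖ ^ 2 := by
      unfold truncOseen
      rw [fderiv_fun_smul hχd
        ((contDiffAt_oseenTensor (norm_pos_iff.1 hz0)).differentiableAt one_ne_zero)]
      calc _ ≤ ‖χ (d⁻¹ • z)‖ * ‖fderiv ℝ oseenTensor z‖
            + ‖fderiv ℝ (fun y => χ (d⁻¹ • y)) z‖ * ‖oseenTensor z‖ := by
            refine (norm_add_le _ _).trans (add_le_add ?_ ?_)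
            · exact (norm_smul _ _).le
            · exact (ContinuousLinearMap.norm_smulRight_apply _ _).le
        _ ≤ 1 * (B / ‖z‖ ^ 2) + K / ‖z‖ * (B / ‖z‖) := by
            gcongr
            rw [Real.norm_of_nonneg (h01 _).1]
            exact (h01 _).2
        _ = _ := by field_simp
    refine ⟨key.trans (by gcongr; nlinarith [mul_pos hK hB]), key.trans ?_⟩
    have hsq : (d / 4) ^ 2 ≤ ‖z‖ ^ 2 := by gcongr
    rw [div_le_div_iff₀ (by positivity) (by positivity)]
    nlinarith [mul_le_mul_of_nonneg_left hsq (by positivity : 0 ≤ B + K * B)]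

/-- The singularity `‖z‖⁻²` is integrable on the unit ball of `ℝ³`. -/
lemma integrable_indicator_ball_norm_sq_inv :
    Integrable ((Metric.ball (0 : E3) 1).indicator fun z => (‖z‖ ^ 2)⁻¹) := by
  rw [integrable_indicator_iff Metric.isOpen_ball.measurableSet,
    integrableOn_fun_norm_addHaar (μ := volume) (f := fun r => (r ^ 2)⁻¹)]
  refine (integrableOn_const (C := (1 : ℝ)) (by simp)).congr_fun (fun r hr => ?_)
    measurableSet_Ioo
  have : r ≠ 0 := hr.1.ne'
  simp [finrank_euclideanSpace, this]

/-- Integration of `‖p - y‖⁻²`, regularised at scale `R`, against a measure with bounded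
density. -/
lemma exists_norm_integral_le_of_density_le : ∃ D : ℝ, 0 < D ∧
    ∀ {F : Type} [NormedAddCommGroup F] [NormedSpace ℝ F] (f : E3 → F) (μ : Measure E3)
      (M R a b : ℝ) (p : E3), IsProbabilityMeasure μ → 0 < M → 0 < R → 0 ≤ a → 0 ≤ b →
      (∀ A : Set E3, μ A ≤ ENNReal.ofReal M * volume A) →
      (∀ᵐ y ∂μ, ‖p - y‖ ≤ R → ‖f y‖ ≤ a) →
      (∀ᵐ y ∂μ, R < ‖p - y‖ → ‖f y‖ ≤ b / ‖p - y‖ ^ 2) →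
      ‖∫ y, f y ∂μ‖ ≤ D * (M * R ^ 3 * a + b * (M + 1)) := by
  set h : E3 → ℝ := (Metric.ball (0 : E3) 1).indicator fun z => (‖z‖ ^ 2)⁻¹ with hh
  have hhInt : Integrable h := integrable_indicator_ball_norm_sq_inv
  have hnn : ∀ z, 0 ≤ h z := fun z => Set.indicator_nonneg (fun _ _ => by positivity) z
  have hle (z : E3) : (‖z‖ ^ 2)⁻¹ ≤ h z + 1 := by
    by_cases hz : z ∈ Metric.ball (0 : E3) 1
    · simp [hh, Set.indicator_of_mem hz]
    · have : 1 ≤ ‖z‖ := by simpa using hz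
      rw [hh, Set.indicator_of_notMem hz, zero_add]
      exact inv_le_one_of_one_le₀ (one_le_pow₀ this)
  have hI : 0 ≤ ∫ z, h z := integral_nonneg hnn
  refine ⟨max (Real.pi * 4 / 3) (max (∫ z, h z) 1), by positivity, ?_⟩
  intro F _ _ f μ M R a b p hμ hM hR ha hb hdens hnear hfar
  have hμle : μ ≤ ENNReal.ofReal M • volume := Measure.le_iff'.2 fun s => by simpa using hdens s
  have hhIntM : Integrable (fun y => h (p - y)) (ENNReal.ofReal M • volume) :=
    (hhInt.comp_sub_left p).smul_measure ENNReal.ofReal_ne_top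
  have hhμ : ∫ y, h (p - y) ∂μ ≤ M * ∫ z, h z := by
    refine (integral_mono_measure hμle (Filter.Eventually.of_forall fun y => hnn _) hhIntM).trans ?_
    rw [integral_smul_measure, integral_sub_left_eq_self h volume p, ENNReal.toReal_ofReal hM.le,
      smul_eq_mul]
  have hball : μ.real (Metric.closedBall p R) ≤ M * (R ^ 3 * (Real.pi * 4 / 3)) := by
    refine ENNReal.toReal_le_of_le_ofReal (by positivity) ((hdens _).trans ?_)
    rw [EuclideanSpace.volume_closedBall_fin_three p R, ENNReal.ofReal_mul hM.le,
      ENNReal.ofReal_mul (by positivity), ENNReal.ofReal_pow hR.le]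
  have hb1 : Integrable ((Metric.closedBall p R).indicator fun _ => a) μ :=
    (integrable_const a).indicator Metric.isClosed_closedBall.measurableSet
  have hb2 : Integrable (fun y => h (p - y) + 1) μ :=
    (hhIntM.mono_measure hμle).add (integrable_const 1)
  calc ‖∫ y, f y ∂μ‖
      ≤ ∫ y, (Metric.closedBall p R).indicator (fun _ => a) y + b * (h (p - y) + 1) ∂μ := by
        refine norm_integral_le_of_norm_le (hb1.add (hb2.const_mul b)) ?_
        filter_upwards [hnear, hfar] with y hy hy'
        have h1 := hnn (p - y)
        rcases le_or_gt ‖p - y‖ R with hr | hr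
        · rw [Set.indicator_of_mem (by rwa [Metric.mem_closedBall, dist_eq_norm_sub'])]
          have : 0 ≤ b * (h (p - y) + 1) := by positivity
          linarith [hy hr]
        · rw [Set.indicator_of_notMem
            (by rwa [Metric.mem_closedBall, dist_eq_norm_sub', not_le]), zero_add]
          exact (hy' hr).trans (mul_le_mul_of_nonneg_left (hle _) hb)
    _ = a * μ.real (Metric.closedBall p R) + b * (∫ y, h (p - y) ∂μ + 1) := by
        rw [integral_add hb1 (hb2.const_mul b), integral_const_mul,
          integral_add (hhIntM.mono_measure hμle) (integrable_const 1),
          integral_indicator_const _ Metric.isClosed_closedBall.measurableSet]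
        simp [mul_comm]
    _ ≤ a * (M * (R ^ 3 * (Real.pi * 4 / 3))) + b * (M * (∫ z, h z) + 1) := by gcongr
    _ = Real.pi * 4 / 3 * (M * R ^ 3 * a) + b * (M * (∫ z, h z) + 1 * 1) := by ring
    _ ≤ max (Real.pi * 4 / 3) (max (∫ z, h z) 1) * (M * R ^ 3 * a)
        + b * (M * max (Real.pi * 4 / 3) (max (∫ z, h z) 1)
          + max (Real.pi * 4 / 3) (max (∫ z, h z) 1) * 1) := by
        gcongr <;> simp
    _ = _ := by ring

/-- for every `K > 0` there is `C > 0` depending only on `K` such that, in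
the transport setting, if moreover `χ` is `C¹` with `‖Dχ‖_∞ ≤ K` and `d_min ≤ 2W`, then
for every `x ∈ ℝ³`,
`‖∫ D(χ_{d_min}Φ)(x − T(y)) dμ(y)‖ ≤ C (M W³/d_min² + M + 1)`. -/
theorem truncated_convolution_derivative_bound :
    ∀ K : ℝ, 0 < K → ∃ C : ℝ, 0 < C ∧
      ∀ (χ : E3 → ℝ),
        (∀ z : E3, χ z ∈ Set.Icc (0 : ℝ) 1) →
        (∀ z : E3, ‖z‖ ≤ 1 / 4 → χ z = 0) →
        (∀ z : E3, 1 / 2 ≤ ‖z‖ → χ z = 1) →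
        ContDiff ℝ 1 χ →
        (∀ z : E3, ‖fderiv ℝ χ z‖ ≤ K) →
      ∀ (N : ℕ) (M W : ℝ) (μ : Measure E3) (T : E3 → E3) (x : Fin N → E3) (dmin : ℝ),
        2 ≤ N → 0 < M → 0 < W →
        IsProbabilityMeasure μ →
        (∀ A : Set E3, μ A ≤ ENNReal.ofReal M * volume A) →
        Measurable T →
        (∀ᵐ y ∂μ, ‖T y - y‖ ≤ W) →
        μ.map T = (N : ℝ≥0∞)⁻¹ • ∑ j : Fin N, Measure.dirac (x j) →
        dmin = sInf {d : ℝ | ∃ i j : Fin N, i ≠ j ∧ d = ‖x i - x j‖} →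
        0 < dmin → dmin ≤ 2 * W →
        ∀ p : E3,
          ‖∫ y, fderiv ℝ (truncOseen χ dmin) (p - T y) ∂μ‖
            ≤ C * (M * W ^ 3 / dmin ^ 2 + M + 1) := by
  intro K hK
  obtain ⟨A, hA, hF⟩ := exists_norm_fderiv_truncOseen_le hK
  obtain ⟨D, hD, hI⟩ := exists_norm_integral_le_of_density_le
  refine ⟨27 * (D * A), by positivity, ?_⟩
  intro χ h01 hχ0 hχ1 hχ hχK N M W μ T x d _ hM hW hμ hdens _ hT _ _ hd _ p
  have hF' := hF χ h01 hχ0 hχ1 hχ hχK d hd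
  refine (hI (fun y => fderiv ℝ (truncOseen χ d) (p - T y)) μ M (3 * W) (A / d ^ 2)
    (A * (9 / 4)) p hμ hM (by positivity) (by positivity) (by positivity) hdens
    (Filter.Eventually.of_forall fun y _ => (hF' _).2) ?_).trans ?_
  · filter_upwards [hT] with y hy hfar
    refine (hF' _).1.trans ?_
    have h1 : ‖p - y‖ ≤ ‖p - T y‖ + ‖T y - y‖ := norm_sub_le_norm_sub_add_norm_sub _ _ _
    have h2 : 2 / 3 * ‖p - y‖ ≤ ‖p - T y‖ := by linarith
    have h3 : 0 < ‖p - y‖ := by linarith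
    calc A / ‖p - T y‖ ^ 2 ≤ A / (2 / 3 * ‖p - y‖) ^ 2 := by gcongr
      _ = _ := by field_simp; norm_num
  · have h1 : 0 ≤ D * A * (M + 1) := by positivity
    calc D * (M * (3 * W) ^ 3 * (A / d ^ 2) + A * (9 / 4) * (M + 1))
        = 27 * (D * A) * (M * W ^ 3 / d ^ 2) + 9 / 4 * (D * A * (M + 1)) := by ring
      _ ≤ 27 * (D * A) * (M * W ^ 3 / d ^ 2) + 27 * (D * A * (M + 1)) := by linarith
      _ = _ := by ring

end
end

section
/- There exists a universal constant C > 0 such that for every compactly supported continuously differentiable function ρ : ℝ³ → ℝ, every x ∈ ℝ³ and every W > 0: ‖∫_{‖x−y‖ ≥ W} D²Φ(x − y)·ρ(y) dy‖ ≤ C·(‖ρ‖_{L^∞} + ‖∇ρ‖_{L¹} + ‖∇ρ‖_{L^∞}), where D²Φ is the second Fréchet derivative of the Oseen tensor; in particular the bound is uniform in x and in the truncation radius W. -/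
open MeasureTheory

noncomputable section

open Set Filter Topology Metric

section Homogeneous

variable {E F : Type*} [NormedAddCommGroup E] [NormedSpace ℝ E]
  [NormedAddCommGroup F] [NormedSpace ℝ F]

theorem fderiv_smul_of_homogeneous {f : E → F} {k : ℕ}
    (hf : ∀ t : ℝ, 0 < t → ∀ z, f (t • z) = (t ^ k)⁻¹ • f z) {t : ℝ} (ht : 0 < t) (z : E) :
    fderiv ℝ f (t • z) = (t ^ (k + 1))⁻¹ • fderiv ℝ f z := by
  have h1 : fderiv ℝ (fun w => f (t • w)) z = t • fderiv ℝ f (t • z) := fderiv_comp_smul t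
  have h2 : (fun w => f (t • w)) = (t ^ k)⁻¹ • f := funext fun w => hf t ht w
  rw [h2, fderiv_const_smul_field, Pi.smul_apply] at h1
  rw [pow_succ, mul_inv_rev, mul_smul, h1, inv_smul_smul₀ ht.ne']

theorem iteratedFDeriv_smul_of_homogeneous {f : E → F} {k : ℕ}
    (hf : ∀ t : ℝ, 0 < t → ∀ z, f (t • z) = (t ^ k)⁻¹ • f z) (n : ℕ) {t : ℝ} (ht : 0 < t)
    (z : E) :
    iteratedFDeriv ℝ n f (t • z) = (t ^ (k + n))⁻¹ • iteratedFDeriv ℝ n f z := by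
  induction n generalizing t z with
  | zero => simp [iteratedFDeriv_zero_eq_comp, hf t ht]
  | succ n ih =>
    rw [iteratedFDeriv_succ_eq_comp_left, Function.comp_apply, Function.comp_apply,
      fderiv_smul_of_homogeneous (fun t ht z => ih ht z) ht, map_smul, add_assoc]

theorem exists_norm_le_of_homogeneous [FiniteDimensional ℝ E] {f : E → F} {k : ℕ} (hk : k ≠ 0)
    (hf : ∀ t : ℝ, 0 < t → ∀ z, f (t • z) = (t ^ k)⁻¹ • f z) (hc : ContinuousOn f {0}ᶜ) :
    ∃ C : ℝ, ∀ z, ‖f z‖ ≤ C * (‖z‖ ^ k)⁻¹ := by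
  have : ProperSpace E := FiniteDimensional.proper ℝ E
  obtain ⟨C, hC⟩ := (isCompact_sphere (0 : E) 1).exists_bound_of_continuousOn
    (hc.mono fun z hz => by
      rintro rfl
      simp at hz)
  refine ⟨C, fun z => ?_⟩
  rcases eq_or_ne z 0 with rfl | hz
  · have h := hf 2 two_pos 0
    rw [smul_zero] at h
    have h0 : f 0 = 0 := by
      by_contra h0
      have h1 : ((2 : ℝ) ^ k)⁻¹ = 1 :=
        smul_left_injective ℝ h0 (h.symm.trans (one_smul ℝ _).symm)
      rw [inv_eq_one, pow_eq_one_iff_of_nonneg two_pos.le hk] at h1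
      norm_num at h1
    simp [h0, hk]
  have hz' : 0 < ‖z‖ := norm_pos_iff.2 hz
  have h := hf ‖z‖ hz' (‖z‖⁻¹ • z)
  rw [smul_inv_smul₀ hz'.ne'] at h
  rw [h, norm_smul, norm_inv, norm_pow, norm_norm, mul_comm]
  gcongr
  exact hC _ (by simp [norm_smul, hz'.ne'])

end Homogeneous

section CutOff

variable {E F : Type*} [NormedAddCommGroup E] [NormedSpace ℝ E]
  [NormedAddCommGroup F] [NormedSpace ℝ F]

theorem contDiff_smul_of_eventuallyEq_zero {n : WithTop ℕ∞} {h : E → ℝ} {g : E → F}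
    (hh : ContDiff ℝ n h) (h0 : h =ᶠ[𝓝 0] 0) (hg : ContDiffOn ℝ n g {0}ᶜ) :
    ContDiff ℝ n fun z => h z • g z := by
  rw [contDiff_iff_contDiffAt]
  intro z
  rcases eq_or_ne z 0 with rfl | hz
  · refine (contDiffAt_const (c := (0 : F))).congr_of_eventuallyEq ?_
    filter_upwards [h0] with w hw
    simp [hw]
  · exact hh.contDiffAt.smul (hg.contDiffAt (isOpen_compl_singleton.mem_nhds hz))

theorem continuous_smul_of_eventuallyEq_zero {h : E → ℝ} {g : E → F}
    (hh : Continuous h) (h0 : h =ᶠ[𝓝 0] 0) (hg : ContinuousOn g {0}ᶜ) :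
    Continuous fun z => h z • g z :=
  contDiff_zero.1 <|
    contDiff_smul_of_eventuallyEq_zero (contDiff_zero.2 hh) h0 (contDiffOn_zero.2 hg)

theorem continuousOn_fderiv_compl_zero {G : E → F} (hG : ContDiffOn ℝ 1 G {0}ᶜ) :
    ContinuousOn (fderiv ℝ G) {0}ᶜ :=
  hG.continuousOn_fderiv_of_isOpen isOpen_compl_singleton le_rfl

variable [MeasurableSpace E] [BorelSpace E] {μ : Measure E}


theorem integrable_smul_of_eventuallyEq_zero [IsFiniteMeasureOnCompacts μ] {h : E → ℝ} {g : E → F}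
    (hh : Continuous h) (hs : HasCompactSupport h) (h0 : h =ᶠ[𝓝 0] 0)
    (hg : ContinuousOn g {0}ᶜ) : Integrable (fun z => h z • g z) μ :=
  (continuous_smul_of_eventuallyEq_zero hh h0 hg).integrable_of_hasCompactSupport hs.smul_right

theorem norm_integral_smul_fderiv_le [FiniteDimensional ℝ E] [μ.IsAddHaarMeasure]
    [CompleteSpace F] {h : E → ℝ} {G : E → F} {b : E → ℝ}
    (hh : ContDiff ℝ 1 h) (hs : HasCompactSupport h) (h0 : h =ᶠ[𝓝 0] 0)
    (hG : ContDiffOn ℝ 1 G {0}ᶜ) (hb : Integrable b μ)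
    (hle : ∀ z, ‖fderiv ℝ h z‖ * ‖G z‖ ≤ b z) :
    ‖∫ z, h z • fderiv ℝ G z ∂μ‖ ≤ ∫ z, b z ∂μ := by
  have hint := integrable_smul_of_eventuallyEq_zero (μ := μ) hh.continuous hs h0
    (continuousOn_fderiv_compl_zero hG)
  refine ContinuousLinearMap.opNorm_le_bound _
    (integral_nonneg fun z => le_trans (by positivity) (hle z)) fun v => ?_
  rw [ContinuousLinearMap.integral_apply hint]
  have hparts : ∫ z, h z • fderiv ℝ G z v ∂μ = -∫ z, fderiv ℝ h z v • G z ∂μ := by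
    refine integral_bilinear_fderiv_right_eq_neg_left_of_integrable (μ := μ)
      (B := ContinuousLinearMap.lsmul ℝ ℝ) ?_ ?_ ?_ ?_ ?_
    · refine integrable_smul_of_eventuallyEq_zero
        ((hh.continuous_fderiv one_ne_zero).clm_apply continuous_const) ?_ ?_ hG.continuousOn
      · exact hs.fderiv_apply ℝ v
      · filter_upwards [h0.fderiv (𝕜 := ℝ)] with z hz
        rw [hz]
        simp
    · exact hint.apply_continuousLinearMap v
    · exact integrable_smul_of_eventuallyEq_zero hh.continuous hs h0 hG.continuousOn
    · exact fun z _ => hh.differentiable one_ne_zero z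
    · intro z hz
      refine (hG.differentiableOn one_ne_zero).differentiableAt
        (isOpen_compl_singleton.mem_nhds ?_)
      rintro rfl
      exact notMem_tsupport_iff_eventuallyEq.2 h0 hz
  simp only [smul_apply]
  rw [hparts, norm_neg, ← integral_mul_const]
  refine norm_integral_le_of_norm_le (hb.mul_const _) (Eventually.of_forall fun z => ?_)
  rw [norm_smul]
  calc ‖fderiv ℝ h z v‖ * ‖G z‖ ≤ (‖fderiv ℝ h z‖ * ‖v‖) * ‖G z‖ := by
        gcongr
        exact (fderiv ℝ h z).le_opNorm v
    _ = (‖fderiv ℝ h z‖ * ‖G z‖) * ‖v‖ := by ring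
    _ ≤ b z * ‖v‖ := by
        gcongr
        exact hle z

end CutOff

/-- A smooth cut-off on `ℝ³`, equal to `1` on the unit ball and to `0` outside the ball of
radius `2`. -/
def unitBump : ContDiffBump (0 : E3) := ⟨1, 2, one_pos, one_lt_two⟩

theorem unitBump_smul_eq_one {c : ℝ} (hc : 0 < c) {z : E3} (hz : ‖z‖ ≤ 1 / c) :
    unitBump (c • z) = 1 := by
  refine unitBump.one_of_mem_closedBall ?_
  rw [mem_closedBall_zero_iff, norm_smul, Real.norm_of_nonneg hc.le]
  exact (le_div_iff₀' hc).1 hz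

theorem unitBump_smul_eq_zero {c : ℝ} (hc : 0 < c) {z : E3} (hz : 2 / c ≤ ‖z‖) :
    unitBump (c • z) = 0 := by
  refine unitBump.zero_of_le_dist ?_
  rw [dist_zero_right, norm_smul, Real.norm_of_nonneg hc.le]
  exact (div_le_iff₀' hc).1 hz

theorem contDiff_unitBump_smul {n : ℕ∞} (c : ℝ) : ContDiff ℝ n fun z : E3 => unitBump (c • z) :=
  unitBump.contDiff.comp (contDiff_const_smul c)

theorem unitBump_smul_eventuallyEq_one {c : ℝ} (hc : 0 < c) :
    (fun z : E3 => unitBump (c • z)) =ᶠ[𝓝 0] 1 := by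
  filter_upwards [closedBall_mem_nhds (0 : E3) (one_div_pos.2 hc)] with z hz
  exact unitBump_smul_eq_one hc (mem_closedBall_zero_iff.1 hz)

theorem exists_norm_fderiv_unitBump_smul_mul_le :
    ∃ D : ℝ, 0 ≤ D ∧ ∀ c : ℝ, 0 < c → ∀ z,
      ‖fderiv ℝ (fun w : E3 => unitBump (c • w)) z‖ * (‖z‖ ^ 2)⁻¹ ≤
        (closedBall (0 : E3) (2 / c)).indicator (fun _ => D * c ^ 3) z := by
  obtain ⟨D, hD⟩ := (unitBump.contDiff.continuous_fderiv one_ne_zero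
    (𝕜 := ℝ)).bounded_above_of_compact_support (unitBump.hasCompactSupport.fderiv ℝ)
  have hD0 : 0 ≤ D := (norm_nonneg _).trans (hD 0)
  refine ⟨D, hD0, fun c hc z => ?_⟩
  have hnonneg : 0 ≤ D * c ^ 3 := by positivity
  have hz_zero (h : fderiv ℝ (fun w : E3 => unitBump (c • w)) z = 0) :
      ‖fderiv ℝ (fun w : E3 => unitBump (c • w)) z‖ * (‖z‖ ^ 2)⁻¹ ≤
        (closedBall (0 : E3) (2 / c)).indicator (fun _ => D * c ^ 3) z := by
    rw [h, norm_zero, zero_mul]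
    exact indicator_nonneg (fun _ _ => hnonneg) z
  rcases lt_or_ge ‖z‖ (1 / c) with h1 | h1
  · refine hz_zero ?_
    have : (fun w : E3 => unitBump (c • w)) =ᶠ[𝓝 z] fun _ => 1 := by
      filter_upwards [isOpen_ball.mem_nhds (mem_ball_zero_iff.2 h1)] with w hw
      exact unitBump_smul_eq_one hc (mem_ball_zero_iff.1 hw).le
    rw [this.fderiv_eq, fderiv_const_apply]
  rcases le_or_gt ‖z‖ (2 / c) with h2 | h2
  · have hz : 0 < ‖z‖ := (one_div_pos.2 hc).trans_le h1
    rw [indicator_of_mem (mem_closedBall_zero_iff.2 h2), fderiv_comp_smul, norm_smul,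
      Real.norm_of_nonneg hc.le]
    have hle : (‖z‖ ^ 2)⁻¹ ≤ c ^ 2 := by
      rw [← inv_pow]
      gcongr
      rw [one_div] at h1
      exact inv_le_of_inv_le₀ hc h1
    calc c * ‖fderiv ℝ unitBump (c • z)‖ * (‖z‖ ^ 2)⁻¹ ≤ c * D * c ^ 2 := by
          gcongr
          exact hD _
      _ = D * c ^ 3 := by ring
  · refine hz_zero ?_
    have : (fun w : E3 => unitBump (c • w)) =ᶠ[𝓝 z] fun _ => 0 := by
      filter_upwards [(isOpen_lt continuous_const continuous_norm).mem_nhds h2] with w hw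
      exact unitBump_smul_eq_zero hc (le_of_lt hw)
    rw [this.fderiv_eq, fderiv_const_apply]

theorem integrable_indicator_closedBall (r a : ℝ) :
    Integrable ((closedBall (0 : E3) r).indicator fun _ => a) :=
  (integrable_indicator_iff measurableSet_closedBall).2
    (integrableOn_const (measure_closedBall_lt_top.ne))

theorem integral_indicator_closedBall_scaled {c : ℝ} (hc : 0 < c) (a : ℝ) :
    ∫ z, (closedBall (0 : E3) (2 / c)).indicator (fun _ => a * c ^ 3) z =
      a * (8 * volume.real (ball (0 : E3) 1)) := by
  rw [integral_indicator_const _ measurableSet_closedBall,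
    Measure.addHaar_real_closedBall _ _ (by positivity), finrank_euclideanSpace_fin, smul_eq_mul]
  field_simp
  norm_num
  ring

theorem integrableOn_inv_norm_sq_ball (r : ℝ) :
    IntegrableOn (fun z : E3 => (‖z‖ ^ 2)⁻¹) (ball 0 r) := by
  rw [integrableOn_fun_norm_addHaar volume (f := fun s => (s ^ 2)⁻¹), finrank_euclideanSpace_fin]
  refine (integrableOn_const (C := (1 : ℝ)) measure_Ioo_lt_top.ne).congr_fun
    (fun s hs => ?_) measurableSet_Ioo
  have : s ≠ 0 := hs.1.ne'
  simp [this]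

variable {F : Type*} [NormedAddCommGroup F] [NormedSpace ℝ F]

theorem norm_setIntegral_ball_unitBump_smul_le {r : E3 → ℝ} {K : E3 → F} {C M c : ℝ}
    (hc : 0 < c) (hC : 0 ≤ C) (hK : ∀ z, ‖K z‖ ≤ C * (‖z‖ ^ 3)⁻¹) (hM : ∀ z, |r z| ≤ M) :
    ‖∫ z in {z : E3 | 2 / c ≤ ‖z‖}ᶜ, ((1 - unitBump (c • z)) * r z) • K z‖ ≤
      8 * volume.real (ball (0 : E3) 1) * (C * M) := by
  have hM0 : 0 ≤ M := (abs_nonneg _).trans (hM 0)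
  rw [← integral_indicator (measurableSet_le measurable_const measurable_norm).compl,
    mul_comm _ (C * M), ← integral_indicator_closedBall_scaled hc]
  refine norm_integral_le_of_norm_le (integrable_indicator_closedBall _ _)
    (Eventually.of_forall fun z => ?_)
  have hnonneg : 0 ≤ C * M * c ^ 3 := by positivity
  by_cases hz : 2 / c ≤ ‖z‖
  · rw [indicator_of_notMem (by simpa using hz), norm_zero]
    exact indicator_nonneg (fun _ _ => hnonneg) z
  rw [indicator_of_mem (by simpa using hz),
    indicator_of_mem (mem_closedBall_zero_iff.2 (not_le.1 hz).le)]
  rcases le_or_gt ‖z‖ (1 / c) with h1 | h1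
  · simpa [unitBump_smul_eq_one hc h1] using hnonneg
  rw [norm_smul, norm_mul, Real.norm_of_nonneg (sub_nonneg.2 unitBump.le_one)]
  have hle : (‖z‖ ^ 3)⁻¹ ≤ c ^ 3 := by
    rw [← inv_pow]
    gcongr
    rw [one_div] at h1
    exact inv_le_of_inv_le₀ hc h1.le
  calc (1 - unitBump (c • z)) * ‖r z‖ * ‖K z‖ ≤ 1 * M * (C * c ^ 3) := by
        gcongr
        · exact sub_le_self _ unitBump.nonneg
        · exact hM z
        · exact (hK z).trans (by gcongr)
    _ = C * M * c ^ 3 := by ring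

theorem norm_integral_unitBump_mul_sub_smul_le {r : E3 → ℝ} {K : E3 → F} {C L c : ℝ}
    (hL0 : 0 ≤ L) (hK : ∀ z, ‖K z‖ ≤ C * (‖z‖ ^ 3)⁻¹) (hr : ∀ z, |r z - r 0| ≤ L * ‖z‖) :
    ‖∫ z, ((1 - unitBump (c • z)) * (unitBump z * (r z - r 0))) • K z‖ ≤
      (∫ z in ball (0 : E3) 2, (‖z‖ ^ 2)⁻¹) * (C * L) := by
  rw [← integral_indicator measurableSet_ball, ← integral_mul_const]
  refine norm_integral_le_of_norm_le
    (((integrable_indicator_iff measurableSet_ball).2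
      (integrableOn_inv_norm_sq_ball 2)).mul_const _) (Eventually.of_forall fun z => ?_)
  by_cases hz : z ∈ ball (0 : E3) 2
  · rw [indicator_of_mem hz, norm_smul, norm_mul, norm_mul,
      Real.norm_of_nonneg (sub_nonneg.2 unitBump.le_one), Real.norm_of_nonneg unitBump.nonneg]
    calc (1 - unitBump (c • z)) * (unitBump z * ‖r z - r 0‖) * ‖K z‖
        ≤ 1 * (1 * (L * ‖z‖)) * (C * (‖z‖ ^ 3)⁻¹) := by
          gcongr
          · exact mul_nonneg unitBump.nonneg (norm_nonneg _)
          · exact sub_le_self _ unitBump.nonneg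
          · exact unitBump.le_one
          · exact hr z
          · exact hK z
      _ = (‖z‖ ^ 2)⁻¹ * (C * L) := by
          rcases eq_or_ne z 0 with rfl | hz0
          · simp
          have := norm_ne_zero_iff.2 hz0
          field_simp
  · have : unitBump z = 0 := by
      refine unitBump.zero_of_le_dist ?_
      rw [dist_zero_right]
      exact not_lt.1 fun h => hz (mem_ball_zero_iff.2 h)
    simp [this, indicator_of_notMem hz]

theorem fderiv_one_sub_mul_interpolation {ψ φ r : E3 → ℝ} (hψ : ContDiff ℝ 1 ψ)
    (hφ : ContDiff ℝ 1 φ) (hr : ContDiff ℝ 1 r) (a : ℝ) (z : E3) :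
    fderiv ℝ (fun w => (1 - φ w) * (ψ w * a + (1 - ψ w) * r w)) z =
      (1 - φ z) • ((a - r z) • fderiv ℝ ψ z + (1 - ψ z) • fderiv ℝ r z) -
        (ψ z * a + (1 - ψ z) * r z) • fderiv ℝ φ z := by
  have hψ' := (hψ.differentiable one_ne_zero z).hasFDerivAt
  have hφ' := (hφ.differentiable one_ne_zero z).hasFDerivAt
  have hr' := (hr.differentiable one_ne_zero z).hasFDerivAt
  have h := (hφ'.const_sub 1).mul ((hψ'.mul_const a).add ((hψ'.const_sub 1).mul hr'))
  refine h.fderiv.trans ?_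
  ext v
  simp
  ring

theorem exists_norm_integral_interpolation_le :
    ∃ D : ℝ, 0 ≤ D ∧ ∀ {F : Type*} [NormedAddCommGroup F] [NormedSpace ℝ F] [CompleteSpace F]
      {r : E3 → ℝ} {G : E3 → F} {C M c : ℝ}, 0 < c → 0 ≤ C → ContDiff ℝ 1 r →
      HasCompactSupport r → ContDiffOn ℝ 1 G {0}ᶜ → (∀ z, ‖G z‖ ≤ C * (‖z‖ ^ 2)⁻¹) →
      (∀ z, |r z| ≤ M) →
      ‖∫ z, ((1 - unitBump (c • z)) * (unitBump z * r 0 + (1 - unitBump z) * r z)) •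
        fderiv ℝ G z‖ ≤ C * (D * M + ∫ z, ‖fderiv ℝ r z‖) := by
  obtain ⟨D, hD0, hD⟩ := exists_norm_fderiv_unitBump_smul_mul_le
  refine ⟨3 * (D * (8 * volume.real (ball (0 : E3) 1))), by positivity, ?_⟩
  intro F _ _ _ r G C M c hc hC hr hrs hG hGC hM
  have hM0 : 0 ≤ M := (abs_nonneg _).trans (hM 0)
  have hψ : ContDiff ℝ 1 unitBump := unitBump.contDiff
  have hφ : ContDiff ℝ 1 fun z : E3 => unitBump (c • z) := contDiff_unitBump_smul c
  have hDr : Integrable fun z => ‖fderiv ℝ r z‖ :=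
    ((hr.continuous_fderiv one_ne_zero).integrable_of_hasCompactSupport (hrs.fderiv ℝ)).norm
  set I : ℝ → E3 → ℝ := fun c => (closedBall (0 : E3) (2 / c)).indicator fun _ => D * c ^ 3
    with hI
  have hIint (c : ℝ) : Integrable (I c) := integrable_indicator_closedBall _ _
  have hb : Integrable fun z => C * (M * I c z + 2 * M * I 1 z + ‖fderiv ℝ r z‖) :=
    ((((hIint c).const_mul _).add ((hIint 1).const_mul _)).add hDr).const_mul _
  refine (norm_integral_smul_fderiv_le (b := fun z =>
    C * (M * I c z + 2 * M * I 1 z + ‖fderiv ℝ r z‖)) ?_ ?_ ?_ hG hb fun z => ?_).trans_eq ?_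
  · fun_prop
  · exact ((unitBump.hasCompactSupport.mul_right).add hrs.mul_left).mul_left
  · filter_upwards [unitBump_smul_eventuallyEq_one hc] with z hz
    rw [hz]
    simp
  · rw [fderiv_one_sub_mul_interpolation hψ hφ hr]
    have hc' := hD c hc z
    have h1' := hD 1 one_pos z
    simp only [one_smul] at h1'
    have hψ0 : 0 ≤ unitBump z := unitBump.nonneg
    have hψ1 : unitBump z ≤ 1 := unitBump.le_one
    have hφ0 : 0 ≤ unitBump (c • z) := unitBump.nonneg
    have hφ1 : unitBump (c • z) ≤ 1 := unitBump.le_one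
    have hmid : |unitBump z * r 0 + (1 - unitBump z) * r z| ≤ M := by
      obtain ⟨h1, h2⟩ := abs_le.1 (hM 0)
      obtain ⟨h3, h4⟩ := abs_le.1 (hM z)
      rw [abs_le]
      constructor <;> nlinarith
    have hsub : |r 0 - r z| ≤ 2 * M := by
      linarith [abs_sub (r 0) (r z), hM 0, hM z]
    have hfar : (1 - unitBump z) * (‖z‖ ^ 2)⁻¹ ≤ 1 := by
      rcases le_or_gt ‖z‖ 1 with h | h
      · have : unitBump z = 1 := unitBump.one_of_mem_closedBall (mem_closedBall_zero_iff.2 h)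
        simp [this]
      · exact mul_le_one₀ (sub_le_self _ hψ0) (by positivity)
          (inv_le_one_of_one_le₀ (one_le_pow₀ h.le))
    set a := 1 - unitBump (c • z) with ha
    have ha0 : 0 ≤ a := sub_nonneg.2 hφ1
    have ha1 : a ≤ 1 := sub_le_self _ hφ0
    have hb0 : 0 ≤ 1 - unitBump z := sub_nonneg.2 hψ1
    set w := (‖z‖ ^ 2)⁻¹ with hw
    have hw0 : 0 ≤ w := by positivity
    calc _ ≤ (1 * (2 * M * ‖fderiv ℝ unitBump z‖ + (1 - unitBump z) * ‖fderiv ℝ r z‖) +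
          M * ‖fderiv ℝ (fun w : E3 => unitBump (c • w)) z‖) * (C * w) := by
          gcongr
          · refine (norm_sub_le _ _).trans (add_le_add ?_ ?_)
            · rw [norm_smul, Real.norm_of_nonneg ha0]
              gcongr
              refine (norm_add_le _ _).trans (add_le_add ?_ ?_)
              · rw [norm_smul]
                gcongr
                exact hsub
              · rw [norm_smul, Real.norm_of_nonneg hb0]
            · rw [norm_smul]
              gcongr
              exact hmid
          · exact hGC z
      _ = C * (M * (‖fderiv ℝ (fun w : E3 => unitBump (c • w)) z‖ * w) +
          2 * M * (‖fderiv ℝ unitBump z‖ * w) + ((1 - unitBump z) * w) * ‖fderiv ℝ r z‖) := by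
          ring
      _ ≤ C * (M * I c z + 2 * M * I 1 z + 1 * ‖fderiv ℝ r z‖) := by
          gcongr
      _ = _ := by rw [one_mul]
  · have hint : ∫ z, I c z = D * (8 * volume.real (ball (0 : E3) 1)) :=
      integral_indicator_closedBall_scaled hc D
    have hint1 : ∫ z, I 1 z = D * (8 * volume.real (ball (0 : E3) 1)) :=
      integral_indicator_closedBall_scaled one_pos D
    have hsum := integral_add (((hIint c).const_mul M).add ((hIint 1).const_mul (2 * M))) hDr
    simp only [Pi.add_apply] at hsum
    rw [integral_const_mul, hsum,
      integral_add ((hIint c).const_mul M) ((hIint 1).const_mul (2 * M)),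
      integral_const_mul, integral_const_mul, hint, hint1]
    ring

theorem exists_norm_setIntegral_smul_fderiv_le [CompleteSpace F] {G : E3 → F} {C : ℝ}
    (hC : 0 ≤ C) (hG : ContDiffOn ℝ 1 G {0}ᶜ) (hGC : ∀ z, ‖G z‖ ≤ C * (‖z‖ ^ 2)⁻¹)
    (hK : ∀ z, ‖fderiv ℝ G z‖ ≤ C * (‖z‖ ^ 3)⁻¹) :
    ∃ A : ℝ, 0 ≤ A ∧ ∀ {r : E3 → ℝ} {M L W : ℝ}, 0 < W → ContDiff ℝ 1 r → HasCompactSupport r →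
      (∀ z, |r z| ≤ M) → (∀ z, ‖fderiv ℝ r z‖ ≤ L) →
      ‖∫ z in {z : E3 | W ≤ ‖z‖}, r z • fderiv ℝ G z‖ ≤
        A * (M + (∫ z, ‖fderiv ℝ r z‖) + L) := by
  obtain ⟨D, hD0, hD⟩ := exists_norm_integral_interpolation_le
  set V := 8 * volume.real (ball (0 : E3) 1) with hV
  set I := ∫ z in ball (0 : E3) 2, (‖z‖ ^ 2)⁻¹ with hI
  have hV0 : 0 ≤ V := by positivity
  have hI0 : 0 ≤ I := integral_nonneg fun z => by positivity
  refine ⟨C * (I + D + 1 + V), by positivity, ?_⟩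
  intro r M L W hW hr hrs hM hL
  have hM0 : 0 ≤ M := (abs_nonneg _).trans (hM 0)
  have hL0 : 0 ≤ L := (norm_nonneg _).trans (hL 0)
  obtain ⟨c, hc, rfl⟩ : ∃ c : ℝ, 0 < c ∧ 2 / c = W := ⟨2 / W, by positivity, by field_simp⟩
  have hDG := continuousOn_fderiv_compl_zero hG
  have hφ : Continuous fun z : E3 => unitBump (c • z) :=
    unitBump.continuous.comp (continuous_const_smul c)
  have hψ : Continuous unitBump := unitBump.continuous
  have hrc := hr.continuous
  have hcut {f : E3 → ℝ} (hf : Continuous f) (hfs : HasCompactSupport f) :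
      Integrable fun z => ((1 - unitBump (c • z)) * f z) • fderiv ℝ G z := by
    refine integrable_smul_of_eventuallyEq_zero (by fun_prop) hfs.mul_left ?_ hDG
    filter_upwards [unitBump_smul_eventuallyEq_one hc] with z hz
    rw [hz]
    simp
  have hnear := norm_integral_unitBump_mul_sub_smul_le (c := c) hL0 hK (r := r) fun z => by
    simpa using convex_univ.norm_image_sub_le_of_norm_fderiv_le
      (fun w _ => hr.differentiable one_ne_zero w) (fun w _ => hL w) (mem_univ 0) (mem_univ z)
  have hfar := hD hc hC hr hrs hG hGC hM
  have hin := norm_setIntegral_ball_unitBump_smul_le hc hC hK hM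
  have hmeas : MeasurableSet {z : E3 | 2 / c ≤ ‖z‖} :=
    measurableSet_le measurable_const measurable_norm
  have hout : ∫ z in {z : E3 | 2 / c ≤ ‖z‖}, r z • fderiv ℝ G z =
      ∫ z in {z : E3 | 2 / c ≤ ‖z‖}, ((1 - unitBump (c • z)) * r z) • fderiv ℝ G z := by
    refine setIntegral_congr_fun hmeas fun z hz => ?_
    simp [unitBump_smul_eq_zero hc hz]
  have hsplit : ∫ z, ((1 - unitBump (c • z)) * r z) • fderiv ℝ G z =
      (∫ z, ((1 - unitBump (c • z)) * (unitBump z * (r z - r 0))) • fderiv ℝ G z) +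
      ∫ z, ((1 - unitBump (c • z)) * (unitBump z * r 0 + (1 - unitBump z) * r z)) •
        fderiv ℝ G z := by
    rw [← integral_add
      (hcut (f := fun z => unitBump z * (r z - r 0)) (by fun_prop)
        unitBump.hasCompactSupport.mul_right)
      (hcut (f := fun z => unitBump z * r 0 + (1 - unitBump z) * r z) (by fun_prop)
        (unitBump.hasCompactSupport.mul_right.add hrs.mul_left))]
    congr 1
    funext z
    module
  rw [hout, ← sub_eq_of_eq_add (integral_add_compl hmeas (hcut hrc hrs)).symm, hsplit]
  calc _ ≤ I * (C * L) + C * (D * M + ∫ z, ‖fderiv ℝ r z‖) + V * (C * M) :=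
        (norm_sub_le _ _).trans (add_le_add ((norm_add_le _ _).trans (add_le_add hnear hfar)) hin)
    _ ≤ _ := by
        have h : 0 ≤ C * ((I + D + 1 + V) * (∫ z, ‖fderiv ℝ r z‖) - (∫ z, ‖fderiv ℝ r z‖) +
            (I + 1) * M + (D + 1 + V) * L) := by
          have : (I + D + 1 + V) * (∫ z, ‖fderiv ℝ r z‖) - (∫ z, ‖fderiv ℝ r z‖) =
            (I + D + V) * ∫ z, ‖fderiv ℝ r z‖ := by ring
          rw [this]
          positivity
        linarith

theorem oseenTensor_smul_s15 {t : ℝ} (ht : 0 < t) (z : E3) :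
    oseenTensor (t • z) = (t ^ 1)⁻¹ • oseenTensor z := by
  ext1 y
  simp only [oseenTensor, norm_smul, Real.norm_of_nonneg ht.le, add_apply, smul_apply,
    ContinuousLinearMap.smulRight_apply, innerSL_apply_apply, real_inner_smul_left,
    ContinuousLinearMap.id_apply, smul_smul, smul_add, mul_inv, mul_pow]
  congr 2
  · ring
  · field_simp

theorem contDiffOn_oseenTensor {n : WithTop ℕ∞} : ContDiffOn ℝ n oseenTensor {0}ᶜ := by
  intro z hz
  have hz' : ‖z‖ ≠ 0 := norm_ne_zero_iff.2 hz
  have hn : ContDiffAt ℝ n (fun z : E3 => ‖z‖) z := contDiffAt_norm ℝ hz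
  have hs : ContDiffAt ℝ n (fun z : E3 => (innerSL ℝ z).smulRight z) z :=
    (innerSL ℝ).contDiff.contDiffAt.smulRight contDiffAt_id
  exact (((hn.inv hz').smul contDiffAt_const).add
    (((hn.pow 3).inv (pow_ne_zero 3 hz')).smul hs)).const_smul _ |>.contDiffWithinAt

theorem setIntegral_smul_comp_sub_left (ρ : E3 → ℝ) (K : E3 → F) (x : E3) (W : ℝ) :
    ∫ y in {y : E3 | W ≤ ‖x - y‖}, ρ y • K (x - y) =
      ∫ z in {z : E3 | W ≤ ‖z‖}, ρ (x - z) • K z := by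
  rw [← integral_indicator (measurableSet_le measurable_const (by fun_prop)),
    ← integral_indicator (measurableSet_le measurable_const measurable_norm),
    ← integral_sub_left_eq_self _ volume x]
  congr 1
  funext z
  simp [indicator]

theorem norm_setIntegral_smul_iteratedFDeriv_comp_sub_left (ρ : E3 → ℝ) (f : E3 → F) (n : ℕ)
    (x : E3) (W : ℝ) :
    ‖∫ y in {y : E3 | W ≤ ‖x - y‖}, ρ y • iteratedFDeriv ℝ (n + 1) f (x - y)‖ =
      ‖∫ z in {z : E3 | W ≤ ‖z‖}, ρ (x - z) • fderiv ℝ (iteratedFDeriv ℝ n f) z‖ := by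
  let e := (continuousMultilinearCurryLeftEquiv ℝ (fun _ : Fin (n + 1) => E3) F).symm
  have he (z : E3) : ρ (x - z) • iteratedFDeriv ℝ (n + 1) f z =
      e (ρ (x - z) • fderiv ℝ (iteratedFDeriv ℝ n f) z) := by
    rw [map_smul, iteratedFDeriv_succ_eq_comp_left]
    rfl
  have hcomm : ∫ z in {z : E3 | W ≤ ‖z‖}, e (ρ (x - z) • fderiv ℝ (iteratedFDeriv ℝ n f) z) =
      e (∫ z in {z : E3 | W ≤ ‖z‖}, ρ (x - z) • fderiv ℝ (iteratedFDeriv ℝ n f) z) :=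
    e.toContinuousLinearEquiv.integral_comp_comm (𝕜 := ℝ)
      fun z => ρ (x - z) • fderiv ℝ (iteratedFDeriv ℝ n f) z
  rw [setIntegral_smul_comp_sub_left, integral_congr_ae (Eventually.of_forall he), hcomm,
    e.norm_map]

/-- there is a universal constant `C > 0` such that for every compactly
supported `C¹` function `ρ : ℝ³ → ℝ`, every `x ∈ ℝ³` and every `W > 0`,
`‖∫_{‖x−y‖ ≥ W} D²Φ(x − y) ρ(y) dy‖ ≤ C (‖ρ‖_∞ + ‖∇ρ‖_{L¹} + ‖∇ρ‖_∞)`,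
uniformly in `x` and in the truncation radius `W`. -/
theorem second_derivative_truncated_integral_bound :
    ∃ C : ℝ, 0 < C ∧
      ∀ ρ : E3 → ℝ, ContDiff ℝ 1 ρ → HasCompactSupport ρ →
        ∀ (x : E3) (W : ℝ), 0 < W →
          ‖∫ y in {y : E3 | W ≤ ‖x - y‖}, ρ y • iteratedFDeriv ℝ 2 oseenTensor (x - y)‖
            ≤ C * ((⨆ y : E3, |ρ y|) + (∫ y : E3, ‖fderiv ℝ ρ y‖) +
                ⨆ y : E3, ‖fderiv ℝ ρ y‖) := by
  set G := iteratedFDeriv ℝ 1 oseenTensor with hGdef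
  have hhom {t : ℝ} (ht : 0 < t) (z : E3) : G (t • z) = (t ^ 2)⁻¹ • G z :=
    iteratedFDeriv_smul_of_homogeneous (fun _ => oseenTensor_smul_s15) 1 ht z
  have hG : ContDiffOn ℝ 1 G {0}ᶜ := fun z hz =>
    ((contDiffOn_oseenTensor (n := 2)).contDiffAt (isOpen_compl_singleton.mem_nhds hz)
      |>.iteratedFDeriv_right (by norm_num)).contDiffWithinAt
  obtain ⟨C₁, hC₁⟩ := exists_norm_le_of_homogeneous two_ne_zero (fun _ => hhom) hG.continuousOn
  obtain ⟨C₂, hC₂⟩ := exists_norm_le_of_homogeneous three_ne_zero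
    (fun _ => fderiv_smul_of_homogeneous (fun _ => hhom)) (continuousOn_fderiv_compl_zero hG)
  obtain ⟨A, hA0, hA⟩ := exists_norm_setIntegral_smul_fderiv_le (C := max 0 (max C₁ C₂))
    (le_max_left _ _) hG (fun z => (hC₁ z).trans (by gcongr; simp))
    (fun z => (hC₂ z).trans (by gcongr; simp))
  refine ⟨A + 1, by positivity, fun ρ hρ hρs x W hW => ?_⟩
  have hρ' : HasCompactSupport fun z => ρ (x - z) :=
    hρs.comp_homeomorph (Homeomorph.subLeft x)
  have hder (z : E3) : ‖fderiv ℝ (fun z => ρ (x - z)) z‖ = ‖fderiv ℝ ρ (x - z)‖ := by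
    have h := ((hρ.differentiable one_ne_zero (x - z)).hasFDerivAt.comp z
      ((hasFDerivAt_id z).const_sub x)).fderiv
    rw [show (fun z => ρ (x - z)) = ρ ∘ fun z => x - z from rfl]
    erw [h]
    simp
  have hbdd : BddAbove (range fun y => |ρ y|) :=
    hρ.continuous.abs.bddAbove_range_of_hasCompactSupport (hρs.comp_left abs_zero)
  have hbdd' : BddAbove (range fun y => ‖fderiv ℝ ρ y‖) :=
    (hρ.continuous_fderiv one_ne_zero).norm.bddAbove_range_of_hasCompactSupport (hρs.fderiv ℝ).norm
  have key := hA hW (hρ.comp (contDiff_const.sub contDiff_id)) hρ'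
    (fun z => le_ciSup hbdd (x - z))
    (fun z => (hder z).trans_le (le_ciSup hbdd' (x - z)))
  simp only [Function.comp_def, id, hder] at key
  rw [integral_sub_left_eq_self (fun y => ‖fderiv ℝ ρ y‖) volume x] at key
  rw [norm_setIntegral_smul_iteratedFDeriv_comp_sub_left ρ oseenTensor 1 x W]
  refine key.trans ?_
  gcongr
  · exact add_nonneg (add_nonneg (Real.iSup_nonneg fun _ => abs_nonneg _)
      (integral_nonneg fun _ => norm_nonneg _)) (Real.iSup_nonneg fun _ => norm_nonneg _)
  · exact le_add_of_nonneg_right zero_le_one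

end
end
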